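/- For p, q, r, s ∈ ℕ with p + q = r + s and a, b, c, d ∈ ℂ, define F_{p,q,r,s}(a,b,c,d) = √(p!·q!·r!·s!) · Σ_i a^i b^{p−i} c^{r−i} d^{q−r+i} / (i!·(r−i)!·(p−i)!·(q−r+i)!), the sum over all integers i with 0 ≤ i ≤ min(p, r) and q − r + i ≥ 0. Then for all p, q, r, s ∈ ℕ with p + q = r + s and all a, b, c, d ∈ ℂ satisfying ad − bc = 1: c · F_{p,q,r,s}(a,b,c,d) = (√((q+1)(r+1)) / (p+q+1)) · F_{p,q+1,r+1,s}(a,b,c,d) − (√(p·s) / (p+q+1)) · F_{p−1,q,r,s−1}(a,b,c,d), where in the last term, if p = 0 or s = 0, the coefficient √(p·s) vanishes and the term is interpreted as 0. -/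

import Mathlib

/-- The matrix element `F_{p,q,r,s}(a,b,c,d) = √(p! q! r! s!) ·
∑_i a^i b^{p-i} c^{r-i} d^{q-r+i} / (i! (r-i)! (p-i)! (q-r+i)!)`, the sum over
integers `i` with `0 ≤ i ≤ min p r` and `q - r + i ≥ 0`. -/
noncomputable def Felt (p q r s : ℕ) (a b c d : ℂ) : ℂ :=
  ((Real.sqrt ((p.factorial * q.factorial * r.factorial * s.factorial : ℕ)) : ℝ) : ℂ) *
    ∑ i ∈ (Finset.range (min p r + 1)).filter (fun i => r ≤ q + i),
      a ^ i * b ^ (p - i) * c ^ (r - i) * d ^ (q + i - r) /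
        ((i.factorial * (r - i).factorial * (p - i).factorial *
          (q + i - r).factorial : ℕ) : ℂ)

/-- Divided power with integer exponent, zero for negative exponents. -/
noncomputable def dpw (x : ℂ) (n : ℤ) : ℂ :=
  if 0 ≤ n then x ^ n.toNat / (n.toNat.factorial : ℂ) else 0

lemma dpw_neg (x : ℂ) (n : ℤ) (h : n < 0) : dpw x n = 0 := by
  unfold dpw; rw [if_neg (by omega)]

lemma dpw_nat (x : ℂ) (n : ℤ) (m : ℕ) (h : n = m) :
    dpw x n = x ^ m / (m.factorial : ℂ) := by
  subst h; simp [dpw]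

lemma dpw_mul (x : ℂ) (n : ℤ) : x * dpw x (n - 1) = n * dpw x n := by
  rcases lt_trichotomy n 0 with h | h | h
  · rw [dpw_neg _ _ h, dpw_neg _ _ (by omega)]; simp
  · subst h; rw [dpw_neg _ _ (by omega)]; simp
  · obtain ⟨m, rfl⟩ : ∃ m : ℕ, n = m + 1 := ⟨(n - 1).toNat, by omega⟩
    rw [dpw_nat x (m + 1 - 1) m (by omega), dpw_nat x (m + 1) (m + 1) (by push_cast; rfl),
      Nat.factorial_succ]
    have h1 : ((m.factorial : ℕ) : ℂ) ≠ 0 := by exact_mod_cast m.factorial_ne_zero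
    have h2 : (m : ℂ) + 1 ≠ 0 := by exact_mod_cast m.succ_ne_zero
    push_cast
    field_simp
    ring

/-- Summand with integer exponents. -/
noncomputable def tm (p q r : ℤ) (a b c d : ℂ) (i : ℤ) : ℂ :=
  dpw a i * dpw b (p - i) * dpw c (r - i) * dpw d (q + i - r)

lemma Felt_eq (p q r s : ℕ) (a b c d : ℂ) (M : ℕ) (hM : p + 1 ≤ M) :
    Felt p q r s a b c d =
      ((Real.sqrt ((p.factorial * q.factorial * r.factorial * s.factorial : ℕ)) : ℝ) : ℂ) *
        ∑ i ∈ Finset.range M, tm p q r a b c d (i : ℤ) := by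
  unfold Felt
  congr 1
  have hsub : (Finset.range (min p r + 1)).filter (fun i => r ≤ q + i) ⊆ Finset.range M := by
    intro i hi
    simp only [Finset.mem_filter, Finset.mem_range] at hi ⊢
    omega
  rw [← Finset.sum_subset hsub]
  · apply Finset.sum_congr rfl
    intro i hi
    simp only [Finset.mem_filter, Finset.mem_range] at hi
    unfold tm
    rw [dpw_nat a i i rfl, dpw_nat b (p - i) (p - i) (by omega),
      dpw_nat c (r - i) (r - i) (by omega), dpw_nat d (q + i - r) (q + i - r) (by omega)]
    push_cast
    simp only [div_mul_div_comm]
    congr 1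
    ring
  · intro i _ hi
    simp only [Finset.mem_filter, Finset.mem_range] at hi
    unfold tm
    by_cases h1 : p < i
    · rw [dpw_neg b _ (by omega)]; simp
    by_cases h2 : r < i
    · rw [dpw_neg c _ (by omega)]; simp
    · rw [dpw_neg d _ (by omega)]; simp

lemma tm_sum (p q r : ℤ) (a b c d : ℂ) (hdet : a * d - b * c = 1) (M : ℕ) (hM : p < M) :
    ((p : ℂ) + q + 1) * (c * ∑ i ∈ Finset.range M, tm p q r a b c d (i : ℤ)) =
      ((q : ℂ) + 1) * (r + 1) * ∑ i ∈ Finset.range M, tm p (q + 1) (r + 1) a b c d (i : ℤ) -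
        ∑ i ∈ Finset.range M, tm (p - 1) q r a b c d (i : ℤ) := by
  have hc : ∀ i : ℤ, c * tm p q r a b c d i =
      ((r : ℂ) + 1 - i) * tm p (q + 1) (r + 1) a b c d i := by
    intro i
    have := dpw_mul c (r + 1 - i)
    rw [show r + 1 - i - 1 = r - i by ring] at this
    unfold tm
    rw [show q + 1 + i - (r + 1) = q + i - r by ring]
    push_cast at this
    linear_combination (dpw a i * dpw b (p - i) * dpw d (q + i - r)) * this
  have hbc : ∀ i : ℤ, b * c * tm (p - 1) q r a b c d i =
      ((p : ℂ) - i) * ((r : ℂ) + 1 - i) * tm p (q + 1) (r + 1) a b c d i := by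
    intro i
    have h1 := dpw_mul c (r + 1 - i)
    have h2 := dpw_mul b (p - i)
    rw [show r + 1 - i - 1 = r - i by ring] at h1
    unfold tm
    rw [show q + 1 + i - (r + 1) = q + i - r by ring, show p - 1 - i = p - i - 1 by ring]
    push_cast at h1 h2
    linear_combination (dpw a i * b * dpw b (p - i - 1) * dpw d (q + i - r)) * h1 +
      (dpw a i * dpw d (q + i - r) * ((r : ℂ) + 1 - i) * dpw c (r + 1 - i)) * h2
  have had : ∀ i : ℤ, a * d * tm (p - 1) q r a b c d i =
      ((i + 1 : ℤ) : ℂ) * ((q : ℂ) + (i + 1 : ℤ) - r) *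
        tm p (q + 1) (r + 1) a b c d (i + 1) := by
    intro i
    have h1 := dpw_mul a (i + 1)
    have h2 := dpw_mul d (q + i - r + 1)
    rw [add_sub_cancel_right] at h1 h2
    unfold tm
    rw [show q + 1 + (i + 1) - (r + 1) = q + i - r + 1 by ring,
      show p - (i + 1) = p - 1 - i by ring, show r + 1 - (i + 1) = r - i by ring]
    push_cast at h1 h2 ⊢
    linear_combination (dpw b (p - 1 - i) * dpw c (r - i) * d * dpw d (q + i - r)) * h1 +
      (dpw b (p - 1 - i) * dpw c (r - i) * ((i : ℂ) + 1) * dpw a (i + 1)) * h2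
  have hshift : ∑ i ∈ Finset.range M, a * d * tm (p - 1) q r a b c d (i : ℤ) =
      ∑ i ∈ Finset.range M, ((i : ℤ) : ℂ) * ((q : ℂ) + (i : ℤ) - r) *
        tm p (q + 1) (r + 1) a b c d (i : ℤ) := by
    let G : ℕ → ℂ := fun i => ((i : ℤ) : ℂ) * ((q : ℂ) + (i : ℤ) - r) *
        tm p (q + 1) (r + 1) a b c d (i : ℤ)
    have e1 := Finset.sum_range_succ G M
    have e2 := Finset.sum_range_succ' G M
    have g0 : G 0 = 0 := by simp [G]
    have gM : G M = 0 := by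
      simp only [G, tm]
      rw [dpw_neg b _ (by omega)]; simp
    have e3 : ∑ i ∈ Finset.range M, a * d * tm (p - 1) q r a b c d (i : ℤ) =
        ∑ i ∈ Finset.range M, G (i + 1) := by
      apply Finset.sum_congr rfl
      intro i _
      rw [had]
      simp only [G]
      push_cast
      rfl
    rw [e3]
    change _ = ∑ i ∈ Finset.range M, G i
    rw [g0, e1, gM] at e2
    simpa using e2.symm
  have hone : ∑ i ∈ Finset.range M, tm (p - 1) q r a b c d (i : ℤ) =
      ∑ i ∈ Finset.range M, a * d * tm (p - 1) q r a b c d (i : ℤ) -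
      ∑ i ∈ Finset.range M, b * c * tm (p - 1) q r a b c d (i : ℤ) := by
    rw [← Finset.sum_sub_distrib]
    apply Finset.sum_congr rfl
    intro i _
    linear_combination (-tm (p - 1) q r a b c d i) * hdet
  rw [hone, hshift]
  simp only [Finset.mul_sum]
  rw [← Finset.sum_sub_distrib, ← Finset.sum_sub_distrib]
  apply Finset.sum_congr rfl
  intro i _
  rw [hc, hbc]
  ring

lemma csqrt_mul (m n : ℕ) : ((Real.sqrt (m : ℕ) : ℝ) : ℂ) * ((Real.sqrt (n : ℕ) : ℝ) : ℂ) =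
    ((Real.sqrt ((m * n : ℕ)) : ℝ) : ℂ) := by
  rw [← Complex.ofReal_mul, ← Real.sqrt_mul (Nat.cast_nonneg m), ← Nat.cast_mul]

lemma csqrt_sq_mul (k n : ℕ) : ((Real.sqrt ((k * k * n : ℕ)) : ℝ) : ℂ) =
    (k : ℂ) * ((Real.sqrt (n : ℕ) : ℝ) : ℂ) := by
  rw [← csqrt_mul, Nat.cast_mul, Real.sqrt_mul_self (Nat.cast_nonneg k)]
  simp

/-- For `p + q = r + s` and `ad - bc = 1`:
`c · F_{p,q,r,s} = (√((q+1)(r+1))/(p+q+1)) F_{p,q+1,r+1,s}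
  − (√(ps)/(p+q+1)) F_{p-1,q,r,s-1}`
(the last term vanishing when `p = 0` or `s = 0` since its coefficient is `0`). -/
theorem Felt_mul_c (p q r s : ℕ) (h : p + q = r + s) (a b c d : ℂ)
    (hdet : a * d - b * c = 1) :
    c * Felt p q r s a b c d =
      (((Real.sqrt (((q + 1) * (r + 1) : ℕ)) : ℝ) : ℂ) / ((p + q + 1 : ℕ) : ℂ)) *
          Felt p (q + 1) (r + 1) s a b c d -
        (((Real.sqrt ((p * s : ℕ)) : ℝ) : ℂ) / ((p + q + 1 : ℕ) : ℂ)) *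
          Felt (p - 1) q r (s - 1) a b c d := by
  have key := tm_sum p q r a b c d hdet (p + 1) (by push_cast; omega)
  have hN : ((p + q + 1 : ℕ) : ℂ) ≠ 0 := by exact_mod_cast (p + q).succ_ne_zero
  have hlast : ((Real.sqrt ((p * s : ℕ)) : ℝ) : ℂ) * Felt (p - 1) q r (s - 1) a b c d =
      ((Real.sqrt ((p.factorial * q.factorial * r.factorial * s.factorial : ℕ)) : ℝ) : ℂ) *
        ∑ i ∈ Finset.range (p + 1), tm ((p : ℤ) - 1) q r a b c d (i : ℤ) := by
    by_cases h0 : p = 0 ∨ s = 0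
    · have hz : ∑ i ∈ Finset.range (p + 1), tm ((p : ℤ) - 1) q r a b c d (i : ℤ) = 0 := by
        apply Finset.sum_eq_zero
        intro i _
        unfold tm
        by_cases h1 : p ≤ i
        · rw [dpw_neg b _ (by omega)]; simp
        · rw [dpw_neg d _ (by omega)]; simp
      have hps : p * s = 0 := by simpa using h0
      rw [hz, hps]; simp
    · obtain ⟨p, rfl⟩ : ∃ t, p = t + 1 := ⟨p - 1, by omega⟩
      obtain ⟨s, rfl⟩ : ∃ t, s = t + 1 := ⟨s - 1, by omega⟩
      rw [Felt_eq _ _ _ _ a b c d (p + 1 + 1) (by omega), ← mul_assoc, csqrt_mul]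
      simp only [Nat.add_sub_cancel, Nat.factorial_succ]
      rw [show (p + 1) * (s + 1) * (p.factorial * q.factorial * r.factorial * s.factorial) =
        (p + 1) * p.factorial * q.factorial * r.factorial * ((s + 1) * s.factorial) by ring,
        show ((p + 1 : ℕ) : ℤ) - 1 = (p : ℤ) by push_cast; ring]
  have hfirst : ((Real.sqrt (((q + 1) * (r + 1) : ℕ)) : ℝ) : ℂ) *
        Felt p (q + 1) (r + 1) s a b c d =
      ((Real.sqrt ((p.factorial * q.factorial * r.factorial * s.factorial : ℕ)) : ℝ) : ℂ) *
        (((q : ℂ) + 1) * (r + 1) *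
          ∑ i ∈ Finset.range (p + 1), tm p ((q : ℤ) + 1) ((r : ℤ) + 1) a b c d (i : ℤ)) := by
    rw [Felt_eq _ _ _ _ a b c d (p + 1) le_rfl, ← mul_assoc, csqrt_mul,
      show (q + 1) * (r + 1) * (p.factorial * (q + 1).factorial * (r + 1).factorial *
        s.factorial) = ((q + 1) * (r + 1)) * ((q + 1) * (r + 1)) *
        (p.factorial * q.factorial * r.factorial * s.factorial) by
          simp only [Nat.factorial_succ]; ring, csqrt_sq_mul]
    simp only [Nat.cast_mul, Nat.cast_add, Nat.cast_one]
    ring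
  rw [div_mul_eq_mul_div, div_mul_eq_mul_div, hlast, hfirst, ← sub_div, eq_div_iff hN,
    Felt_eq _ _ _ _ a b c d (p + 1) le_rfl]
  push_cast at key ⊢
  linear_combination
    ((Real.sqrt ((p.factorial * q.factorial * r.factorial * s.factorial : ℝ)) : ℝ) : ℂ) * key
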